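/- Let M₀ be a finite-dimensional complex symmetric Leibniz algebra with dim C(M₀) = 1, and let R be its radical. Then there exist two Lie subalgebras L₁, L₂ of M₀ which are maximal totally isotropic subspaces of M₀ (and maximal elements of the poset of Lie subalgebras of M₀), such that L₁ ∩ L₂ = R, H := L₁ + L₂ is a two-sided ideal of M₀ of codimension at most 1, and H = M₀ if and only if dim(M₀/R) is even. -/

import Mathlib

open Submodule

section LeibnizDefs

variable {M : Type*} [AddCommGroup M] [Module ℂ M]

/-- The left Leibniz identity for a bilinear bracket. -/
def IsLeftLeibniz (br : M →ₗ[ℂ] M →ₗ[ℂ] M) : Prop :=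
  ∀ a b c : M, br a (br b c) = br (br a b) c + br b (br a c)

/-- The right Leibniz identity for a bilinear bracket. -/
def IsRightLeibniz (br : M →ₗ[ℂ] M →ₗ[ℂ] M) : Prop :=
  ∀ a b c : M, br (br a b) c = br (br a c) b + br a (br b c)

/-- Left central: `[a,[b,b]] = 0` for all `a, b`. -/
def IsLeftCentral (br : M →ₗ[ℂ] M →ₗ[ℂ] M) : Prop :=
  ∀ a b : M, br a (br b b) = 0

/-- The Leibniz kernel `C(M)`, the span of all squares `[a,a]`. -/
def leibnizKernel (br : M →ₗ[ℂ] M →ₗ[ℂ] M) : Submodule ℂ M :=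
  Submodule.span ℂ {x | ∃ a : M, br a a = x}

/-- A two-sided ideal of a Leibniz algebra. -/
def IsTwoSidedIdeal (br : M →ₗ[ℂ] M →ₗ[ℂ] M) (U : Submodule ℂ M) : Prop :=
  ∀ m u : M, u ∈ U → br m u ∈ U ∧ br u m ∈ U

/-- A Lie subalgebra: a subspace closed under the bracket on which the bracket is alternating. -/
def IsLieSubalgebra (br : M →ₗ[ℂ] M →ₗ[ℂ] M) (L : Submodule ℂ M) : Prop :=
  (∀ a ∈ L, ∀ b ∈ L, br a b ∈ L) ∧ ∀ a ∈ L, br a a = 0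

/-- The derived series of a subspace. -/
def leibDerivedSeries (br : M →ₗ[ℂ] M →ₗ[ℂ] M) (U : Submodule ℂ M) : ℕ → Submodule ℂ M
  | 0 => U
  | n + 1 => Submodule.span ℂ
      {x | ∃ a ∈ leibDerivedSeries br U n, ∃ b ∈ leibDerivedSeries br U n, br a b = x}

/-- Solvability of a subspace. -/
def IsLeibnizSolvable (br : M →ₗ[ℂ] M →ₗ[ℂ] M) (U : Submodule ℂ M) : Prop :=
  ∃ n : ℕ, leibDerivedSeries br U n = ⊥

/-- `B` is the solvable radical: the largest solvable two-sided ideal. -/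
def IsSolvableRadical (br : M →ₗ[ℂ] M →ₗ[ℂ] M) (B : Submodule ℂ M) : Prop :=
  IsTwoSidedIdeal br B ∧ IsLeibnizSolvable br B ∧
    ∀ U : Submodule ℂ M, IsTwoSidedIdeal br U → IsLeibnizSolvable br U → U ≤ B

/-- Semisimplicity of a bracket-closed subspace `S` on which the bracket is a Lie bracket,
expressed via the standard characterization (valid for finite-dimensional complex Lie
algebras): `S` has no nonzero abelian ideal. -/
def IsSemisimpleSubalgebra (br : M →ₗ[ℂ] M →ₗ[ℂ] M) (S : Submodule ℂ M) : Prop :=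
  ∀ A : Submodule ℂ M, A ≤ S →
    (∀ s ∈ S, ∀ a ∈ A, br s a ∈ A ∧ br a s ∈ A) →
    (∀ a ∈ A, ∀ b ∈ A, br a b = 0) → A = ⊥

/-- The truncated exponential series of an endomorphism; if `f ^ n = 0` this is `exp f`. -/
noncomputable def expSum (f : Module.End ℂ M) (n : ℕ) : Module.End ℂ M :=
  ∑ i ∈ Finset.range n, ((i.factorial : ℂ)⁻¹) • f ^ i

/-- A subspace `A` with `R ≤ A` whose image in `M/R` is a (two-sided) ideal. -/
def IsIdealAbove (br : M →ₗ[ℂ] M →ₗ[ℂ] M) (R A : Submodule ℂ M) : Prop :=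
  R ≤ A ∧ ∀ m a : M, a ∈ A → br m a ∈ A ∧ br a m ∈ A

/-- The derived series relative to `R` (computing the derived series of the image in `M/R`). -/
def derivedSeriesMod (br : M →ₗ[ℂ] M →ₗ[ℂ] M) (R U : Submodule ℂ M) : ℕ → Submodule ℂ M
  | 0 => U ⊔ R
  | n + 1 => Submodule.span ℂ
      {x | ∃ a ∈ derivedSeriesMod br R U n, ∃ b ∈ derivedSeriesMod br R U n, br a b = x} ⊔ R

/-- Solvability of the image of `U` in `M/R`. -/
def IsSolvableMod (br : M →ₗ[ℂ] M →ₗ[ℂ] M) (R U : Submodule ℂ M) : Prop :=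
  ∃ n : ℕ, derivedSeriesMod br R U n ≤ R

/-- `B/R` is the solvable radical of `M/R`. -/
def IsSolvableRadicalMod (br : M →ₗ[ℂ] M →ₗ[ℂ] M) (R B : Submodule ℂ M) : Prop :=
  IsIdealAbove br R B ∧ IsSolvableMod br R B ∧
    ∀ U : Submodule ℂ M, IsIdealAbove br R U → IsSolvableMod br R U → U ≤ B

/-- Semisimplicity of `L/R` as a Lie algebra, expressed via the standard characterization:
no ideal of `L/R` strictly between `R` and `L` is abelian, except the zero one. -/
def IsSemisimpleMod (br : M →ₗ[ℂ] M →ₗ[ℂ] M) (R L : Submodule ℂ M) : Prop :=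
  ∀ A : Submodule ℂ M, R ≤ A → A ≤ L →
    (∀ l ∈ L, ∀ a ∈ A, br l a ∈ A ∧ br a l ∈ A) →
    (∀ a ∈ A, ∀ b ∈ A, br a b ∈ R) → A = R

/-- The lower central series of `L` relative to `R`. -/
def lowerCentralSeriesMod (br : M →ₗ[ℂ] M →ₗ[ℂ] M) (R L : Submodule ℂ M) :
    ℕ → Submodule ℂ M
  | 0 => L ⊔ R
  | n + 1 => Submodule.span ℂ
      {x | ∃ a ∈ L, ∃ b ∈ lowerCentralSeriesMod br R L n, br a b = x} ⊔ R

/-- Nilpotency of `L/R`. -/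
def IsNilpotentMod (br : M →ₗ[ℂ] M →ₗ[ℂ] M) (R L : Submodule ℂ M) : Prop :=
  ∃ n : ℕ, lowerCentralSeriesMod br R L n ≤ R

/-- A totally isotropic subspace for the pairing `ψ(a,b) = [a,b] + [b,a]`. -/
def IsTotallyIsotropic (br : M →ₗ[ℂ] M →ₗ[ℂ] M) (U : Submodule ℂ M) : Prop :=
  ∀ a ∈ U, ∀ b ∈ U, br a b + br b a = 0

end LeibnizDefs

section SymmetricForms

variable {V : Type*} [AddCommGroup V] [Module ℂ V]

/-- A symmetric bilinear form on a finite-dimensional complex space is the pullback of the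
standard sum-of-squares form along a surjective linear map. -/
theorem LinearMap.BilinForm.exists_surjective_eq_sum_mul [FiniteDimensional ℂ V]
    (B : LinearMap.BilinForm ℂ V) (hB : B.IsSymm) :
    ∃ (n : ℕ) (f : V →ₗ[ℂ] (Fin n → ℂ)), Function.Surjective f ∧
      ∀ x y, B x y = ∑ i, f x i * f y i := by
  classical
  obtain ⟨v, hv⟩ := LinearMap.BilinForm.exists_orthogonal_basis
    (LinearMap.BilinForm.isSymm_iff.1 hB)
  choose s hs using fun i => IsAlgClosed.exists_pow_nat_eq (B (v i) (v i)) two_pos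
  let S := {i // s i ≠ 0}
  let e : Fin (Fintype.card S) ≃ S := (Fintype.equivFin S).symm
  let f : V →ₗ[ℂ] (Fin (Fintype.card S) → ℂ) :=
    LinearMap.pi fun k => s (e k) • v.coord (e k)
  refine ⟨Fintype.card S, f, fun z => ?_, fun x y => ?_⟩
  · refine ⟨v.equivFun.symm fun i => if h : s i ≠ 0 then (s i)⁻¹ * z (e.symm ⟨i, h⟩) else 0, ?_⟩
    ext k
    have hk : s (e k) ≠ 0 := (e k).2
    simp only [f, LinearMap.pi_apply, LinearMap.smul_apply, Module.Basis.coord_apply,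
      ← Module.Basis.equivFun_apply, LinearEquiv.apply_symm_apply, smul_eq_mul]
    simp [hk]
  · have key : B x y = ∑ i, s i * v.repr x i * (s i * v.repr y i) := by
      conv_lhs => rw [← LinearMap.sum_repr_mul_repr_mul v v]
      rw [Finsupp.sum_fintype _ _ (by simp)]
      refine Finset.sum_congr rfl fun i _ => ?_
      rw [Finsupp.sum_fintype _ _ (by simp), Finset.sum_eq_single i]
      · rw [← hs i]; simp only [smul_eq_mul]; ring
      · intro j _ hj
        have : B (v i) (v j) = 0 := hv hj.symm
        simp [this]
      · simp
    rw [key]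
    have h2 : ∑ k, f x k * f y k =
        ∑ i : S, s i * v.repr x i * (s i * v.repr y i) :=
      Fintype.sum_equiv e _ _ fun k => by simp [f]
    rw [h2, ← Finset.sum_subtype (p := fun i => s i ≠ 0) (Finset.univ.filter fun i => s i ≠ 0) (by simp)
      fun i => s i * v.repr x i * (s i * v.repr y i)]
    symm
    refine Finset.sum_filter_of_ne fun i _ hi h => hi ?_
    simp [h]

/-- A symmetric bilinear form on a finite-dimensional complex space is the pullback of an
orthogonal sum of hyperbolic planes and at most one anisotropic line. -/
theorem LinearMap.BilinForm.exists_surjective_eq_hyperbolic [FiniteDimensional ℂ V]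
    (B : LinearMap.BilinForm ℂ V) (hB : B.IsSymm) :
    ∃ (m r : ℕ) (f : V →ₗ[ℂ] (Fin m → ℂ) × (Fin m → ℂ) × (Fin r → ℂ)), r ≤ 1 ∧
      Function.Surjective f ∧
      ∀ x y, B x y = ∑ k, ((f x).1 k * (f y).2.1 k + (f x).2.1 k * (f y).1 k) +
        ∑ j, (f x).2.2 j * (f y).2.2 j := by
  obtain ⟨n, g, hg, hgB⟩ := B.exists_surjective_eq_sum_mul hB
  let e : Fin (n / 2) ⊕ Fin (n / 2) ⊕ Fin (n % 2) ≃ Fin n :=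
    Fintype.equivFinOfCardEq (by simp; omega)
  let p (k) : V →ₗ[ℂ] ℂ := LinearMap.proj (e (.inl k)) ∘ₗ g
  let q (k) : V →ₗ[ℂ] ℂ := LinearMap.proj (e (.inr (.inl k))) ∘ₗ g
  let t (k) : V →ₗ[ℂ] ℂ := LinearMap.proj (e (.inr (.inr k))) ∘ₗ g
  refine ⟨n / 2, n % 2, (LinearMap.pi fun k => p k + Complex.I • q k).prod
    ((LinearMap.pi fun k => (2⁻¹ : ℂ) • (p k - Complex.I • q k)).prod (LinearMap.pi t)),
    by omega, ?_, fun x y => ?_⟩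
  · rintro ⟨a, b, c⟩
    obtain ⟨x, hx⟩ := hg fun i => Sum.elim (fun k => (a k + 2 * b k) / 2)
      (Sum.elim (fun k => - Complex.I * (a k - 2 * b k) / 2) c) (e.symm i)
    refine ⟨x, ?_⟩
    refine Prod.ext (funext fun k => ?_) (Prod.ext (funext fun k => ?_) (funext fun k => ?_))
    · simp [p, q, hx]
      linear_combination (-(a k - 2 * b k) / 2) * Complex.I_mul_I
    · simp [p, q, hx]
      linear_combination ((a k - 2 * b k) / 4) * Complex.I_mul_I
    · simp [t, hx]
  · rw [hgB, ← e.sum_comp, Fintype.sum_sum_type, Fintype.sum_sum_type, ← add_assoc,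
      ← Finset.sum_add_distrib]
    congr 1
    refine Finset.sum_congr rfl fun k _ => ?_
    simp [p, q]
    linear_combination (g x (e (.inr (.inl k))) * g y (e (.inr (.inl k)))) * Complex.I_mul_I

end SymmetricForms

section Leibniz

variable {M : Type*} [AddCommGroup M] [Module ℂ M] {br : M →ₗ[ℂ] M →ₗ[ℂ] M}

theorem add_swap_eq_zero_of_isLeftLeibniz_of_isRightLeibniz (hl : IsLeftLeibniz br)
    (hr : IsRightLeibniz br) (a b c : M) : br (br a b) c + br c (br a b) = 0 := by
  have h₁ := hl a c b
  have h₂ := hr a c b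
  linear_combination (norm := module) (-1 : ℂ) • h₁ + (-1 : ℂ) • h₂

theorem add_swap_mem_leibnizKernel (br : M →ₗ[ℂ] M →ₗ[ℂ] M) (a b : M) :
    br a b + br b a ∈ leibnizKernel br := by
  have h (x : M) : br x x ∈ leibnizKernel br := subset_span ⟨x, rfl⟩
  have := sub_mem (sub_mem (h (a + b)) (h a)) (h b)
  convert this using 1
  simp only [map_add, LinearMap.add_apply]
  abel

theorem IsLieSubalgebra.isTotallyIsotropic {L : Submodule ℂ M} (hL : IsLieSubalgebra br L) :
    IsTotallyIsotropic br L := by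
  intro a ha b hb
  have h := hL.2 _ (L.add_mem ha hb)
  simpa [hL.2 a ha, hL.2 b hb, add_comm] using h

theorem IsTotallyIsotropic.isLieSubalgebra {U : Submodule ℂ M} (hU : IsTotallyIsotropic br U)
    (hbr : ∀ a b, br a b ∈ U) : IsLieSubalgebra br U :=
  ⟨fun a _ b _ => hbr a b, fun a ha => by
    have h := hU a ha a ha
    rwa [← two_smul ℂ, smul_eq_zero_iff_right two_ne_zero] at h⟩

/-- The form `[a,b] + [b,a]` takes values in a line when the Leibniz kernel does. -/
theorem exists_bilinForm_of_finrank_leibnizKernel_eq_one (br : M →ₗ[ℂ] M →ₗ[ℂ] M)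
    (h : Module.finrank ℂ (leibnizKernel br) = 1) :
    ∃ B : LinearMap.BilinForm ℂ M, B.IsSymm ∧ ∀ x y, B x y = 0 ↔ br x y + br y x = 0 := by
  let f : leibnizKernel br ≃ₗ[ℂ] ℂ :=
    haveI := Module.finite_of_finrank_eq_succ h
    LinearEquiv.ofFinrankEq _ _ (h.trans (Module.finrank_self ℂ).symm)
  obtain ⟨g, hg⟩ := f.toLinearMap.exists_extend
  have hgf (x y : M) : g (br x y + br y x) = f ⟨_, add_swap_mem_leibnizKernel br x y⟩ := by
    rw [← LinearEquiv.coe_coe, ← hg]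
    rfl
  refine ⟨(br + br.flip).compr₂ g, ⟨fun x y => by simp [add_comm]⟩, fun x y => ?_⟩
  have h₁ : (br + br.flip).compr₂ g x y = g (br x y + br y x) := rfl
  rw [h₁, hgf, LinearEquiv.map_eq_zero_iff, Submodule.mk_eq_zero]

end Leibniz

/-- (Section 6)  A symmetric Leibniz algebra `M₀` of rank `1` contains two
Lie subalgebras `L₁, L₂` which are maximal totally isotropic subspaces and maximal Lie
subalgebras, with `L₁ ∩ L₂ = R`, `H = L₁ + L₂` a two-sided ideal of codimension at most
`1`, and `H = M₀` iff `dim (M₀/R)` is even. -/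
theorem symmetric_rank_one_structure (M₀ : Type*) [AddCommGroup M₀] [Module ℂ M₀]
    [FiniteDimensional ℂ M₀] (br : M₀ →ₗ[ℂ] M₀ →ₗ[ℂ] M₀)
    (hleib : IsLeftLeibniz br) (hright : IsRightLeibniz br)
    (hrk : Module.finrank ℂ (leibnizKernel br) = 1)
    (R : Submodule ℂ M₀) (hR : ∀ x : M₀, x ∈ R ↔ ∀ a : M₀, br x a + br a x = 0) :
    ∃ L₁ L₂ : Submodule ℂ M₀,
      IsLieSubalgebra br L₁ ∧ IsLieSubalgebra br L₂ ∧
      IsTotallyIsotropic br L₁ ∧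
      (∀ U : Submodule ℂ M₀, IsTotallyIsotropic br U → L₁ ≤ U → U = L₁) ∧
      IsTotallyIsotropic br L₂ ∧
      (∀ U : Submodule ℂ M₀, IsTotallyIsotropic br U → L₂ ≤ U → U = L₂) ∧
      (∀ L' : Submodule ℂ M₀, IsLieSubalgebra br L' → L₁ ≤ L' → L' = L₁) ∧
      (∀ L' : Submodule ℂ M₀, IsLieSubalgebra br L' → L₂ ≤ L' → L' = L₂) ∧
      L₁ ⊓ L₂ = R ∧
      IsTwoSidedIdeal br (L₁ ⊔ L₂) ∧
      Module.finrank ℂ (M₀ ⧸ (L₁ ⊔ L₂)) ≤ 1 ∧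
      ((L₁ ⊔ L₂) = ⊤ ↔ Even (Module.finrank ℂ (M₀ ⧸ R))) := by
  obtain ⟨B, hB, hB0⟩ := exists_bilinForm_of_finrank_leibnizKernel_eq_one br hrk
  obtain ⟨m, r, f, hr, hf, hfB⟩ := B.exists_surjective_eq_hyperbolic hB
  have hker : LinearMap.ker f = R := by
    ext x
    rw [hR, LinearMap.mem_ker]
    refine ⟨fun hx a => (hB0 x a).1 (by simp [hfB, hx]), fun hx => ?_⟩
    have hx' (y) : B x y = 0 := (hB0 x y).2 (hx y)
    refine Prod.ext (funext fun k => ?_) (Prod.ext (funext fun k => ?_) (funext fun k => ?_))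
    · obtain ⟨y, hy⟩ := hf (0, Pi.single k 1, 0)
      simpa [hfB, hy, Pi.single_apply] using hx' y
    · obtain ⟨y, hy⟩ := hf (Pi.single k 1, 0, 0)
      simpa [hfB, hy, Pi.single_apply] using hx' y
    · obtain ⟨y, hy⟩ := hf (0, 0, Pi.single k 1)
      simpa [hfB, hy, Pi.single_apply] using hx' y
  have hbr (U : Submodule ℂ M₀) (hU : R ≤ U) (a b : M₀) : br a b ∈ U :=
    hU <| (hR _).2 fun c => add_swap_eq_zero_of_isLeftLeibniz_of_isRightLeibniz hleib hright a b c
  let L₁ : Submodule ℂ M₀ := (Submodule.prod ⊥ (Submodule.prod ⊤ ⊥)).comap f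
  let L₂ : Submodule ℂ M₀ := (Submodule.prod ⊤ (Submodule.prod ⊥ ⊥)).comap f
  let T : M₀ →ₗ[ℂ] (Fin r → ℂ) := LinearMap.snd ℂ _ _ ∘ₗ LinearMap.snd ℂ _ _ ∘ₗ f
  have hT : Function.Surjective T := fun c =>
    let ⟨y, hy⟩ := hf (0, 0, c)
    ⟨y, by simp [T, hy]⟩
  have mem₁ (x) : x ∈ L₁ ↔ (f x).1 = 0 ∧ (f x).2.2 = 0 := by
    simp [L₁, Submodule.mem_prod]
  have mem₂ (x) : x ∈ L₂ ↔ (f x).2.1 = 0 ∧ (f x).2.2 = 0 := by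
    simp [L₂, Submodule.mem_prod, Prod.ext_iff]
  have hR₁ : R ≤ L₁ := hker ▸ fun x hx => (mem₁ x).2 (by simp [LinearMap.mem_ker.1 hx])
  have hR₂ : R ≤ L₂ := hker ▸ fun x hx => (mem₂ x).2 (by simp [LinearMap.mem_ker.1 hx])
  have iso₁ : IsTotallyIsotropic br L₁ := fun a ha b hb => (hB0 a b).1 <| by
    simp [hfB, (mem₁ a).1 ha, (mem₁ b).1 hb]
  have iso₂ : IsTotallyIsotropic br L₂ := fun a ha b hb => (hB0 a b).1 <| by
    simp [hfB, (mem₂ a).1 ha, (mem₂ b).1 hb]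
  have anis (c : Fin r → ℂ) (hc : ∑ j, c j * c j = 0) : c = 0 := by
    have : Subsingleton (Fin r) := Fin.subsingleton_iff_le_one.2 hr
    ext j
    simpa [Fintype.sum_subsingleton _ j] using hc
  have max₁ (U : Submodule ℂ M₀) (hU : IsTotallyIsotropic br U) (h : L₁ ≤ U) : U = L₁ := by
    refine le_antisymm (fun u hu => ?_) h
    have h1 : (f u).1 = 0 := funext fun k => by
      obtain ⟨y, hy⟩ := hf (0, Pi.single k 1, 0)
      simpa [hfB, hy, Pi.single_apply] using
        (hB0 u y).2 (hU u hu y (h ((mem₁ y).2 (by simp [hy]))))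
    refine (mem₁ u).2 ⟨h1, anis _ ?_⟩
    simpa [hfB, h1] using (hB0 u u).2 (hU u hu u hu)
  have max₂ (U : Submodule ℂ M₀) (hU : IsTotallyIsotropic br U) (h : L₂ ≤ U) : U = L₂ := by
    refine le_antisymm (fun u hu => ?_) h
    have h1 : (f u).2.1 = 0 := funext fun k => by
      obtain ⟨y, hy⟩ := hf (Pi.single k 1, 0, 0)
      simpa [hfB, hy, Pi.single_apply] using
        (hB0 u y).2 (hU u hu y (h ((mem₂ y).2 (by simp [hy]))))
    refine (mem₂ u).2 ⟨h1, anis _ ?_⟩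
    simpa [hfB, h1] using (hB0 u u).2 (hU u hu u hu)
  have hsup : L₁ ⊔ L₂ = LinearMap.ker T := by
    refine le_antisymm (sup_le (fun x hx => ?_) fun x hx => ?_) fun x hx => ?_
    · exact ((mem₁ x).1 hx).2
    · exact ((mem₂ x).1 hx).2
    · have hx : (f x).2.2 = 0 := hx
      obtain ⟨y, hy⟩ := hf (0, (f x).2.1, 0)
      exact mem_sup.2 ⟨y, (mem₁ y).2 (by simp [hy]), x - y, (mem₂ _).2 (by simp [hy, hx]),
        by simp⟩
  have hcodim : Module.finrank ℂ (M₀ ⧸ (L₁ ⊔ L₂)) = r := by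
    rw [hsup, (T.quotKerEquivOfSurjective hT).finrank_eq, Module.finrank_fin_fun]
  have hdim : Module.finrank ℂ (M₀ ⧸ R) = m + (m + r) := by
    rw [← hker, (f.quotKerEquivOfSurjective hf).finrank_eq]
    simp
  refine ⟨L₁, L₂, iso₁.isLieSubalgebra (hbr _ hR₁), iso₂.isLieSubalgebra (hbr _ hR₂),
    iso₁, max₁, iso₂, max₂, fun L' h => max₁ L' h.isTotallyIsotropic,
    fun L' h => max₂ L' h.isTotallyIsotropic, ?_,
    fun a u _ => ⟨hbr _ (hR₁.trans le_sup_left) _ _, hbr _ (hR₁.trans le_sup_left) _ _⟩,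
    hcodim.trans_le hr, ?_⟩
  · rw [← hker]
    ext x
    rw [Submodule.mem_inf, mem₁, mem₂, LinearMap.mem_ker, Prod.ext_iff, Prod.ext_iff]
    simp only [Prod.fst_zero, Prod.snd_zero]
    tauto
  · rw [hdim, ← Submodule.Quotient.subsingleton_iff, ← Module.finrank_zero_iff (R := ℂ), hcodim,
      Nat.even_iff]
    omega
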